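/- arXiv:2406.08569 — 2 statements merged into one kernel-verified Lean document; each statement's English description precedes it below -/
import Mathlib

section
/- Let M ∈ ℝ^{d×d} be a symmetric positive definite matrix with positive definite square root M^{1/2}, let Δ > 0, μ > 0 and c = Δ/μ. For v ∈ ℝ^d let Q_v be the pushforward of the standard Gaussian product measure on ℝ^d (the law of a vector of d i.i.d. standard normals) under the map z ↦ v + c · M^{1/2} z, so Q_v is the law of v + cZ with Z ∼ N(0, M). Then for all v, w ∈ ℝ^d with ‖M^{−1/2}(v − w)‖₂ ≤ Δ, all ε ≥ 0, and every measurable S ⊆ ℝ^d, Q_v(S) ≤ e^ε · Q_w(S) + δ_μ(ε), where δ_μ(ε) = Φ(−ε/μ + μ/2) − e^ε · Φ(−ε/μ − μ/2). (The correlated-noise Gaussian mechanism with multiplier c = Δ/μ is μ-GDP.) -/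
open MeasureTheory ProbabilityTheory

/-- The cumulative distribution function Φ of the standard normal distribution on ℝ. -/
noncomputable def stdNormalCDF (x : ℝ) : ℝ :=
  ((gaussianReal 0 1) (Set.Iic x)).toReal

/-- The Gaussian privacy curve δ_μ(ε) = Φ(−ε/μ + μ/2) − e^ε · Φ(−ε/μ − μ/2). -/
noncomputable def gdpCurve (μ ε : ℝ) : ℝ :=
  stdNormalCDF (-ε / μ + μ / 2) - Real.exp ε * stdNormalCDF (-ε / μ - μ / 2)

open scoped ENNReal NNReal

/-- Neyman–Pearson: among all events, the set where the density exceeds `k` maximizes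
`Q A - k * P A`, for `Q` the measure with density `f` with respect to `P`. -/
theorem withDensity_add_mul_le_of_threshold {Ω : Type*} [MeasurableSpace Ω] (P : Measure Ω)
    {f : Ω → ℝ≥0∞} {k : ℝ≥0∞} {A B : Set Ω} (hA : MeasurableSet A)
    (hB : MeasurableSet B) (hkf : ∀ x ∈ B, k ≤ f x) (hfk : ∀ x ∉ B, f x ≤ k) :
    P.withDensity f A + k * P B ≤ k * P A + P.withDensity f B := by
  have hAB : P.withDensity f (A \ B) ≤ k * P (A \ B) := by
    rw [withDensity_apply _ (hA.diff hB), ← setLIntegral_const]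
    exact setLIntegral_mono' (hA.diff hB) fun x hx => hfk x hx.2
  have hBA : k * P (B \ A) ≤ P.withDensity f (B \ A) := by
    rw [withDensity_apply _ (hB.diff hA), ← setLIntegral_const]
    exact setLIntegral_mono' (hB.diff hA) fun x hx => hkf x hx.1
  rw [← measure_inter_add_sdiff (μ := P.withDensity f) A hB,
    ← measure_inter_add_sdiff (μ := P.withDensity f) B hA,
    ← measure_inter_add_sdiff (μ := P) A hB, ← measure_inter_add_sdiff (μ := P) B hA,
    Set.inter_comm B A, mul_add, mul_add]
  calc _ = P.withDensity f (A ∩ B) + k * P (A ∩ B)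
          + (P.withDensity f (A \ B) + k * P (B \ A)) := by ring
    _ ≤ P.withDensity f (A ∩ B) + k * P (A ∩ B)
          + (k * P (A \ B) + P.withDensity f (B \ A)) := by gcongr
    _ = _ := by ring

/-- Cameron–Martin formula for the standard Gaussian on the real line. -/
theorem gaussianReal_map_add_const_eq_withDensity (a : ℝ) :
    (gaussianReal 0 1).map (· + a) =
      (gaussianReal 0 1).withDensity fun x => ENNReal.ofReal (Real.exp (a * x - a ^ 2 / 2)) := by
  rw [gaussianReal_map_add_const, gaussianReal_of_var_ne_zero _ one_ne_zero,
    gaussianReal_of_var_ne_zero _ one_ne_zero,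
    ← withDensity_mul _ (measurable_gaussianPDF 0 1) (by fun_prop)]
  congr 1
  ext x
  rw [Pi.mul_apply, gaussianPDF, gaussianPDF, ← ENNReal.ofReal_mul (gaussianPDFReal_nonneg _ _ _),
    gaussianPDFReal, gaussianPDFReal, mul_assoc _ (Real.exp _), ← Real.exp_add]
  congr 3
  simp only [NNReal.coe_one]
  ring

/-- A product of probability measures with densities has the product density. -/
theorem pi_withDensity_eq {ι : Type*} [Fintype ι] {α : ι → Type*} [∀ i, MeasurableSpace (α i)]
    (P : ∀ i, Measure (α i)) [∀ i, IsProbabilityMeasure (P i)] {f : ∀ i, α i → ℝ≥0∞}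
    (hf : ∀ i, Measurable (f i)) [∀ i, SigmaFinite ((P i).withDensity (f i))] :
    Measure.pi (fun i => (P i).withDensity (f i)) =
      (Measure.pi P).withDensity fun z => ∏ i, f i (z i) := by
  refine Measure.pi_eq fun s hs => ?_
  have hm : ∀ i, Measurable ((s i).indicator (f i)) := fun i => (hf i).indicator (hs i)
  rw [withDensity_apply _ (MeasurableSet.univ_pi hs),
    ← lintegral_indicator (MeasurableSet.univ_pi hs)]
  have hind : (Set.univ.pi s).indicator (fun z => ∏ i, f i (z i)) =
      fun z => ∏ i, (s i).indicator (f i) (z i) := by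
    ext z
    by_cases hz : z ∈ Set.univ.pi s
    · rw [Set.indicator_of_mem hz]
      exact Finset.prod_congr rfl fun i _ => (Set.indicator_of_mem (hz i trivial) _).symm
    · rw [Set.indicator_of_notMem hz]
      obtain ⟨i, hi⟩ : ∃ i, z i ∉ s i := by simpa [Set.mem_pi] using hz
      exact (Finset.prod_eq_zero (Finset.mem_univ i) (Set.indicator_of_notMem hi _)).symm
  have hindep : iIndepFun (fun i (z : ∀ i, α i) => (s i).indicator (f i) (z i)) (Measure.pi P) :=
    iIndepFun_pi fun i => (hm i).aemeasurable
  rw [hind, lintegral_prod_eq_prod_lintegral_of_indepFun Finset.univ _ hindep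
    fun i => (hm i).comp (measurable_pi_apply i)]
  refine Finset.prod_congr rfl fun i _ => ?_
  rw [(measurePreserving_eval P i).lintegral_comp (hm i), lintegral_indicator (hs i),
    withDensity_apply _ (hs i)]

/-- Cameron–Martin formula for the standard Gaussian product measure. -/
theorem pi_gaussianReal_map_add_const {ι : Type*} [Fintype ι] (a : ι → ℝ) :
    (Measure.pi fun _ : ι => gaussianReal 0 1).map (· + a) =
      (Measure.pi fun _ : ι => gaussianReal 0 1).withDensity fun z =>
        ENNReal.ofReal (Real.exp (∑ i, a i * z i - (∑ i, a i ^ 2) / 2)) := by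
  have hd : ∀ i, IsProbabilityMeasure ((gaussianReal 0 1).withDensity
      fun x => ENNReal.ofReal (Real.exp (a i * x - a i ^ 2 / 2))) := fun i => by
    rw [← gaussianReal_map_add_const_eq_withDensity]
    exact Measure.isProbabilityMeasure_map (by fun_prop)
  have hmap := Measure.pi_map_pi (μ := fun _ : ι => gaussianReal 0 1) (f := fun i x => x + a i)
    fun i => by fun_prop
  simp_rw [gaussianReal_map_add_const_eq_withDensity] at hmap
  rw [pi_withDensity_eq (fun _ : ι => gaussianReal 0 1) (fun i => by fun_prop)] at hmap
  refine hmap.trans (congrArg _ (funext fun z => ?_))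
  rw [← ENNReal.ofReal_prod_of_nonneg fun i _ => (Real.exp_pos _).le, ← Real.exp_sum,
    Finset.sum_sub_distrib, Finset.sum_div]

/-- Linear functionals of a standard Gaussian vector are centered Gaussians. -/
theorem pi_gaussianReal_map_sum_mul {ι : Type*} [Fintype ι] (a : ι → ℝ) :
    (Measure.pi fun _ : ι => gaussianReal 0 1).map (fun z => ∑ i, a i * z i) =
      gaussianReal 0 (∑ i, a i ^ 2).toNNReal := by
  let L : StrongDual ℝ (EuclideanSpace ℝ ι) := innerSL ℝ (WithLp.toLp 2 a)
  have hL : (fun z : ι → ℝ => ∑ i, a i * z i) = L ∘ WithLp.toLp 2 := by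
    ext z
    simp [L, PiLp.inner_apply, mul_comm]
  rw [hL, ← Measure.map_map (by fun_prop) (by fun_prop), map_pi_eq_stdGaussian,
    IsGaussian.map_eq_gaussianReal, integral_strongDual_stdGaussian, variance_dual_stdGaussian,
    innerSL_apply_norm, EuclideanSpace.real_norm_sq_eq]

theorem gaussianReal_sq_Ici {μ : ℝ} (hμ : 0 < μ) (t : ℝ) :
    gaussianReal 0 (μ ^ 2).toNNReal (Set.Ici t) = ENNReal.ofReal (stdNormalCDF (-t / μ)) := by
  have hmap : (gaussianReal 0 1).map (-μ * ·) = gaussianReal 0 (μ ^ 2).toNNReal := by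
    rw [gaussianReal_map_const_mul]
    congr 1
    · simp
    · ext
      simp [sq_nonneg]
  rw [stdNormalCDF, ENNReal.ofReal_toReal (measure_ne_top _ _), ← hmap,
    Measure.map_apply (by fun_prop) measurableSet_Ici]
  congr 1
  ext x
  simp only [Set.mem_preimage, Set.mem_Ici, Set.mem_Iic, le_div_iff₀ hμ]
  constructor <;> intro h <;> linarith

/-- Privacy curve of the shift of a standard Gaussian vector by a vector of norm `μ`. -/
theorem pi_gaussianReal_map_add_const_le {ι : Type*} [Fintype ι] {μ : ℝ} (hμ : 0 < μ) (ε : ℝ)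
    {a : ι → ℝ} (ha : ∑ i, a i ^ 2 = μ ^ 2) {A : Set (ι → ℝ)} (hA : MeasurableSet A) :
    (Measure.pi fun _ : ι => gaussianReal 0 1).map (· + a) A ≤
      ENNReal.ofReal (Real.exp ε) * (Measure.pi fun _ : ι => gaussianReal 0 1) A +
        ENNReal.ofReal (gdpCurve μ ε) := by
  set γ := Measure.pi fun _ : ι => gaussianReal 0 1
  let B : Set (ι → ℝ) := {z | ε + μ ^ 2 / 2 ≤ ∑ i, a i * z i}
  have hB : MeasurableSet B := measurableSet_le measurable_const (by fun_prop)
  have hlaw (t : ℝ) : γ {z | t ≤ ∑ i, a i * z i} = ENNReal.ofReal (stdNormalCDF (-t / μ)) := by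
    rw [← gaussianReal_sq_Ici hμ, ← ha, ← pi_gaussianReal_map_sum_mul,
      Measure.map_apply (by fun_prop) measurableSet_Ici]
    rfl
  have hγB : γ B = ENNReal.ofReal (stdNormalCDF (-ε / μ - μ / 2)) := by
    rw [hlaw]
    congr 2
    field_simp
    ring
  have hshiftB : γ.map (· + a) B = ENNReal.ofReal (stdNormalCDF (-ε / μ + μ / 2)) := by
    rw [Measure.map_apply (by fun_prop) hB]
    have : (· + a) ⁻¹' B = {z | ε - μ ^ 2 / 2 ≤ ∑ i, a i * z i} := by
      ext z
      simp only [B, Set.mem_preimage, Set.mem_ofPred_eq, Pi.add_apply, mul_add,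
        Finset.sum_add_distrib, ← pow_two, ha]
      constructor <;> intro h <;> linarith
    rw [this, hlaw]
    congr 2
    field_simp
    ring
  have key := withDensity_add_mul_le_of_threshold γ
    (f := fun z => ENNReal.ofReal (Real.exp (∑ i, a i * z i - (∑ i, a i ^ 2) / 2)))
    (k := ENNReal.ofReal (Real.exp ε)) hA hB
    (fun z hz => ENNReal.ofReal_le_ofReal (Real.exp_le_exp.2 (by
      rw [ha]; linarith [show ε + μ ^ 2 / 2 ≤ ∑ i, a i * z i from hz])))
    (fun z hz => ENNReal.ofReal_le_ofReal (Real.exp_le_exp.2 (by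
      rw [ha]; linarith [not_le.1 (show ¬ ε + μ ^ 2 / 2 ≤ ∑ i, a i * z i from hz)])))
  rw [← pi_gaussianReal_map_add_const, hshiftB, hγB,
    ← ENNReal.ofReal_mul (Real.exp_pos ε).le] at key
  rw [gdpCurve, ENNReal.ofReal_sub _
    (by unfold stdNormalCDF; positivity : 0 ≤ Real.exp ε * stdNormalCDF (-ε / μ - μ / 2))]
  exact (ENNReal.le_sub_of_add_le_right ENNReal.ofReal_ne_top key).trans add_tsub_le_assoc

theorem measurePreserving_tail_pi {α : Type*} [MeasurableSpace α] (P : Measure α)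
    [IsProbabilityMeasure P] (d : ℕ) :
    MeasurePreserving (fun z : Fin (d + 1) → α => Fin.tail z) (Measure.pi fun _ => P)
      (Measure.pi fun _ => P) :=
  measurePreserving_snd.comp (measurePreserving_piFinSuccAbove (fun _ : Fin (d + 1) => P) 0)

/-- Shifts of norm at most `μ` reduce to shifts of norm exactly `μ` by adding one coordinate. -/
theorem pi_gaussianReal_map_add_const_le_of_sum_sq_le {d : ℕ} {μ : ℝ} (hμ : 0 < μ) (ε : ℝ)
    {a : Fin d → ℝ} (ha : ∑ i, a i ^ 2 ≤ μ ^ 2) {A : Set (Fin d → ℝ)} (hA : MeasurableSet A) :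
    (Measure.pi fun _ : Fin d => gaussianReal 0 1).map (· + a) A ≤
      ENNReal.ofReal (Real.exp ε) * (Measure.pi fun _ : Fin d => gaussianReal 0 1) A +
        ENNReal.ofReal (gdpCurve μ ε) := by
  let b : Fin (d + 1) → ℝ := Fin.cons (Real.sqrt (μ ^ 2 - ∑ i, a i ^ 2)) a
  have hb : ∑ i, b i ^ 2 = μ ^ 2 := by
    simp [b, Fin.sum_univ_succ, Real.sq_sqrt (sub_nonneg.2 ha)]
  have htail := measurePreserving_tail_pi (gaussianReal 0 1) d
  have h := pi_gaussianReal_map_add_const_le hμ ε hb (htail.measurable hA)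
  rw [htail.measure_preimage hA.nullMeasurableSet,
    Measure.map_apply (by fun_prop) (htail.measurable hA)] at h
  rw [Measure.map_apply (by fun_prop) hA,
    ← htail.measure_preimage (hA.preimage (by fun_prop)).nullMeasurableSet]
  exact h

/-- The correlated-noise Gaussian mechanism with multiplier c = Δ/μ is μ-GDP:
`R` is the positive definite square root of the covariance `M`, the mechanism releases
`v + c • R z` with `z` a vector of i.i.d. standard normals, and the sensitivity is measured
in the Mahalanobis norm `‖M^{-1/2}(v - w)‖₂ = ‖R⁻¹ (v - w)‖₂`. -/
theorem correlated_gaussian_mechanism_gdp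
    (d : ℕ) (hd : 1 ≤ d)
    (M R : Matrix (Fin d) (Fin d) ℝ)
    (hM : M.PosDef) (hR : R.PosDef) (hRM : R * R = M)
    (Δ μ : ℝ) (hΔ : 0 < Δ) (hμ : 0 < μ) (c : ℝ) (hc : c = Δ / μ)
    (v w : Fin d → ℝ)
    (hvw : Real.sqrt (∑ i, (R⁻¹.mulVec (v - w) i) ^ 2) ≤ Δ)
    (ε : ℝ) (hε : 0 ≤ ε) (S : Set (Fin d → ℝ)) (hS : MeasurableSet S) :
    Measure.map (fun z => v + c • R.mulVec z)
        (Measure.pi fun _ : Fin d => gaussianReal 0 1) S ≤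
      ENNReal.ofReal (Real.exp ε) *
        Measure.map (fun z => w + c • R.mulVec z)
          (Measure.pi fun _ : Fin d => gaussianReal 0 1) S +
        ENNReal.ofReal (gdpCurve μ ε) := by
  have hc0 : 0 < c := hc ▸ div_pos hΔ hμ
  let a : Fin d → ℝ := c⁻¹ • R⁻¹.mulVec (v - w)
  have ha : ∑ i, a i ^ 2 ≤ μ ^ 2 := by
    have hsq : ∑ i, (R⁻¹.mulVec (v - w) i) ^ 2 ≤ Δ ^ 2 := (Real.sqrt_le_left hΔ.le).1 hvw
    have hcμ : μ = c⁻¹ * Δ := by rw [hc]; field_simp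
    calc ∑ i, a i ^ 2 = c⁻¹ ^ 2 * ∑ i, (R⁻¹.mulVec (v - w) i) ^ 2 := by
          simp [a, mul_pow, Finset.mul_sum]
      _ ≤ c⁻¹ ^ 2 * Δ ^ 2 := by gcongr
      _ = μ ^ 2 := by rw [hcμ]; ring
  have hshift : (fun z => v + c • R.mulVec z) = (fun z => w + c • R.mulVec z) ∘ (· + a) := by
    funext z
    have hRa : c • R.mulVec a = v - w := by
      rw [Matrix.mulVec_smul, smul_inv_smul₀ hc0.ne', Matrix.mulVec_mulVec,
        Matrix.mul_nonsing_inv _ ((Matrix.isUnit_iff_isUnit_det R).1 hR.isUnit),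
        Matrix.one_mulVec]
    simp only [Function.comp_apply, Matrix.mulVec_add, smul_add, hRa]
    abel
  have hmeas (u : Fin d → ℝ) : Measurable fun z => u + c • R.mulVec z :=
    (continuous_const.add ((Continuous.matrix_mulVec continuous_const
      continuous_id).const_smul c)).measurable
  rw [hshift, ← Measure.map_map (hmeas w) (by fun_prop), Measure.map_apply (hmeas w) hS,
    Measure.map_apply (hmeas w) hS]
  exact pi_gaussianReal_map_add_const_le_of_sum_sq_le hμ ε ha (hmeas w hS)
end

section
/- Let n ≥ 1, Δ_d, Δ_s > 0, σ > 0, and set μ = √(n(Δ_s² + Δ_d²))/σ. Let u, u' ∈ (ℝ × ℝ)^n be two vectors of n pairs such that for every index i, |u_i,1 − u'_i,1| ≤ Δ_d and |u_i,2 − u'_i,2| ≤ Δ_s. Let P_u denote the isotropic Gaussian measure on (ℝ²)^n ≅ ℝ^{2n} with mean u and variance σ² in each coordinate. Then for all ε ≥ 0 and every measurable S, P_u(S) ≤ e^ε · P_{u'}(S) + δ_μ(ε), where δ_μ(ε) = Φ(−ε/μ + μ/2) − e^ε · Φ(−ε/μ − μ/2). (Releasing n pointwise evaluations of the density and signal channels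 with the Gaussian mechanism of noise variance σ² is μ-GDP with μ = √(n(Δ_s² + Δ_d²)/σ²).) -/
open MeasureTheory ProbabilityTheory

open scoped NNReal ENNReal

lemma map_withDensity_comp {Ω Ω' : Type*} [MeasurableSpace Ω] [MeasurableSpace Ω']
    (Q : Measure Ω) {g : Ω → Ω'} (hg : Measurable g) {f : Ω' → ℝ≥0∞} (hf : Measurable f) :
    (Q.withDensity (f ∘ g)).map g = (Q.map g).withDensity f := by
  ext S hS
  rw [Measure.map_apply hg hS, withDensity_apply _ (hg hS), withDensity_apply _ hS,
    setLIntegral_map hS hf hg]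
  rfl

/-- The log-likelihood ratio of `P` with respect to `Q` is, under `Q`, Gaussian with mean `-s / 2`
and variance `s`, as is the case for two Gaussian measures with common covariance. -/
def HasGaussianLogLikelihood {Ω : Type*} [MeasurableSpace Ω] (s : ℝ≥0) (P Q : Measure Ω) : Prop :=
  ∃ L : Ω → ℝ, Measurable L ∧ P = Q.withDensity (fun x => ENNReal.ofReal (Real.exp (L x))) ∧
    Q.map L = gaussianReal (-(s : ℝ) / 2) s

lemma gaussianReal_eq_withDensity_gaussianReal (a b : ℝ) {v : ℝ≥0} (hv : v ≠ 0) :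
    gaussianReal a v = (gaussianReal b v).withDensity
      (fun x => ENNReal.ofReal (Real.exp ((a - b) / v * (x - b) - (a - b) ^ 2 / v / 2))) := by
  have hv' : (v : ℝ) ≠ 0 := by exact_mod_cast hv
  rw [gaussianReal_of_var_ne_zero a hv, gaussianReal_of_var_ne_zero b hv,
    ← withDensity_mul _ (measurable_gaussianPDF b v) (by fun_prop)]
  congr 1
  ext x
  rw [Pi.mul_apply, gaussianPDF, gaussianPDF, ← ENNReal.ofReal_mul (gaussianPDFReal_nonneg _ _ _),
    gaussianPDFReal, gaussianPDFReal, mul_assoc _ (Real.exp _), ← Real.exp_add]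
  congr 3
  field_simp
  ring

namespace HasGaussianLogLikelihood

lemma of_gaussianReal (a b : ℝ) {v : ℝ≥0} (hv : v ≠ 0) :
    HasGaussianLogLikelihood (Real.nnabs (a - b) ^ 2 / v) (gaussianReal a v) (gaussianReal b v) := by
  have hv' : (v : ℝ) ≠ 0 := by exact_mod_cast hv
  refine ⟨_, by fun_prop, gaussianReal_eq_withDensity_gaussianReal a b hv, ?_⟩
  have h : (fun x : ℝ => (a - b) / v * (x - b) - (a - b) ^ 2 / v / 2) =
      (fun x => x - (a - b) ^ 2 / v / 2) ∘ (fun x => (a - b) / v * x) ∘ (fun x => x - b) := by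
    ext x; simp
  rw [h, ← Measure.map_map (by fun_prop) (by fun_prop), ← Measure.map_map (by fun_prop)
    (by fun_prop), gaussianReal_map_sub_const, gaussianReal_map_const_mul,
    gaussianReal_map_sub_const]
  congr 1
  · simp [neg_div]
  · ext
    simp
    field_simp

lemma prod {Ω Ω' : Type*} [MeasurableSpace Ω] [MeasurableSpace Ω'] {s t : ℝ≥0}
    {P Q : Measure Ω} {P' Q' : Measure Ω'} [IsProbabilityMeasure Q] [IsProbabilityMeasure Q']
    (h : HasGaussianLogLikelihood s P Q) (h' : HasGaussianLogLikelihood t P' Q') :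
    HasGaussianLogLikelihood (s + t) (P.prod P') (Q.prod Q') := by
  obtain ⟨L, hL, hP, hQ⟩ := h
  obtain ⟨L', hL', hP', hQ'⟩ := h'
  refine ⟨fun z => L z.1 + L' z.2, by fun_prop, ?_, ?_⟩
  · rw [hP, hP', prod_withDensity (by fun_prop) (by fun_prop)]
    congr 1
    ext z
    rw [Real.exp_add, ENNReal.ofReal_mul (Real.exp_pos _).le]
  · have h : (fun z : Ω × Ω' => L z.1 + L' z.2) = (fun z : ℝ × ℝ => z.1 + z.2) ∘ Prod.map L L' := rfl
    rw [h, ← Measure.map_map (by fun_prop) (by fun_prop), ← Measure.map_prod_map _ _ hL hL', hQ, hQ']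
    change Measure.conv _ _ = _
    rw [gaussianReal_conv_gaussianReal]
    congr 1
    push_cast
    ring

lemma of_measurableEquiv {Ω Ω' : Type*} [MeasurableSpace Ω] [MeasurableSpace Ω'] {s : ℝ≥0}
    {P Q : Measure Ω} {P' Q' : Measure Ω'} (e : Ω ≃ᵐ Ω') (hP : MeasurePreserving e P P')
    (hQ : MeasurePreserving e Q Q') (h : HasGaussianLogLikelihood s P' Q') :
    HasGaussianLogLikelihood s P Q := by
  obtain ⟨L, hL, hd, hm⟩ := h
  refine ⟨L ∘ e, hL.comp e.measurable, ?_, ?_⟩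
  · apply e.map_measurableEquiv_injective
    rw [hP.map_eq, hd, ← hQ.map_eq, ← map_withDensity_comp Q e.measurable (by fun_prop)]
    rfl
  · rw [← Measure.map_map hL e.measurable, hQ.map_eq, hm]

lemma pi {Ω : Type*} [MeasurableSpace Ω] {n : ℕ} {s : Fin n → ℝ≥0} {P Q : Fin n → Measure Ω}
    [∀ i, IsProbabilityMeasure (P i)] [∀ i, IsProbabilityMeasure (Q i)]
    (h : ∀ i, HasGaussianLogLikelihood (s i) (P i) (Q i)) :
    HasGaussianLogLikelihood (∑ i, s i) (Measure.pi P) (Measure.pi Q) := by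
  induction n with
  | zero =>
    refine ⟨fun _ => 0, measurable_const, ?_, ?_⟩
    · rw [Measure.pi_of_empty P, Measure.pi_of_empty Q]
      simp
    · simp [Measure.map_const]
  | succ n ih =>
    rw [Fin.sum_univ_succ]
    exact of_measurableEquiv (MeasurableEquiv.piFinSuccAbove (fun _ => Ω) 0)
      (measurePreserving_piFinSuccAbove P 0) (measurePreserving_piFinSuccAbove Q 0)
      ((h 0).prod (ih fun i => h i.succ))

end HasGaussianLogLikelihood

lemma gaussianReal_real_Ici (m : ℝ) {μ : ℝ} (hμ : 0 < μ) {v : ℝ≥0} (hv : (v : ℝ) = μ ^ 2)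
    (x : ℝ) : (gaussianReal m v).real (Set.Ici x) = stdNormalCDF ((m - x) / μ) := by
  have h : gaussianReal m v = (gaussianReal 0 1).map ((fun z => m - z) ∘ (fun z => μ * z)) := by
    rw [← Measure.map_map (by fun_prop) (by fun_prop), gaussianReal_map_const_mul,
      gaussianReal_map_const_sub]
    congr 1
    · simp
    · ext
      simp [hv]
  rw [h, map_measureReal_apply (by fun_prop) measurableSet_Ici, stdNormalCDF]
  change (gaussianReal 0 1).real _ = (gaussianReal 0 1).real _
  congr 1
  ext z
  simp only [Function.comp_apply, Set.mem_preimage, Set.mem_Ici, Set.mem_Iic, le_div_iff₀ hμ]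
  constructor <;> intro h <;> linarith

/-- The testing inequality of Neyman and Pearson, in its sharp form: the excess of `P` over
`exp ε * Q` is largest on the event that the likelihood ratio is at least `exp ε`. -/
lemma measureReal_sub_le_of_withDensity_exp {Ω : Type*} [MeasurableSpace Ω] {P Q : Measure Ω}
    [IsFiniteMeasure P] [IsFiniteMeasure Q] {L : Ω → ℝ} (hL : Measurable L)
    (hP : P = Q.withDensity (fun x => ENNReal.ofReal (Real.exp (L x)))) (ε : ℝ)
    {S : Set Ω} (hS : MeasurableSet S) :
    P.real S - Real.exp ε * Q.real S ≤
      P.real (L ⁻¹' Set.Ici ε) - Real.exp ε * Q.real (L ⁻¹' Set.Ici ε) := by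
  set A := L ⁻¹' Set.Ici ε with hA
  have hAm : MeasurableSet A := hL measurableSet_Ici
  have key_le : P.real (S \ A) ≤ Real.exp ε * Q.real (S \ A) := by
    have : P (S \ A) ≤ ENNReal.ofReal (Real.exp ε) * Q (S \ A) := by
      rw [hP, withDensity_apply _ (hS.diff hAm), ← setLIntegral_const]
      refine setLIntegral_mono measurable_const fun x hx => ?_
      have hx' : L x < ε := by simpa [hA] using hx.2
      gcongr
    have := ENNReal.toReal_mono (by finiteness) this
    rwa [ENNReal.toReal_mul, ENNReal.toReal_ofReal (Real.exp_pos _).le] at this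
  have key_ge : Real.exp ε * Q.real (A \ S) ≤ P.real (A \ S) := by
    have : ENNReal.ofReal (Real.exp ε) * Q (A \ S) ≤ P (A \ S) := by
      conv_rhs => rw [hP, withDensity_apply _ (hAm.diff hS)]
      rw [← setLIntegral_const]
      refine setLIntegral_mono (by fun_prop) fun x hx => ?_
      have hx' : ε ≤ L x := hx.1
      gcongr
    have := ENNReal.toReal_mono (by finiteness) this
    rwa [ENNReal.toReal_mul, ENNReal.toReal_ofReal (Real.exp_pos _).le] at this
  have e1 := measureReal_inter_add_sdiff (μ := P) (s := S) hAm
  have e2 := measureReal_inter_add_sdiff (μ := Q) (s := S) hAm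
  have e3 := measureReal_inter_add_sdiff (μ := P) (s := A) hS
  have e4 := measureReal_inter_add_sdiff (μ := Q) (s := A) hS
  rw [Set.inter_comm] at e3 e4
  rw [← e1, ← e2, ← e3, ← e4]
  linarith

theorem HasGaussianLogLikelihood.le_gdpCurve {Ω : Type*} [MeasurableSpace Ω] {P Q : Measure Ω}
    [IsFiniteMeasure P] [IsFiniteMeasure Q] {s : ℝ≥0} (h : HasGaussianLogLikelihood s P Q)
    {μ : ℝ} (hμ : 0 < μ) (hs : (s : ℝ) = μ ^ 2) (ε : ℝ) {S : Set Ω} (hS : MeasurableSet S) :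
    P S ≤ ENNReal.ofReal (Real.exp ε) * Q S + ENNReal.ofReal (gdpCurve μ ε) := by
  obtain ⟨L, hL, hP, hQ⟩ := h
  have hs0 : s ≠ 0 := by
    rintro rfl
    exact (pow_pos hμ 2).ne hs
  have hs0' : (s : ℝ) ≠ 0 := by exact_mod_cast hs0
  have hPL : P.map L = gaussianReal (s / 2) s := by
    rw [gaussianReal_eq_withDensity_gaussianReal _ (-(s : ℝ) / 2) hs0, ← hQ, hP]
    have := map_withDensity_comp Q hL (f := fun x => ENNReal.ofReal (Real.exp x)) (by fun_prop)
    refine this.trans ?_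
    congr 1
    ext x
    congr 2
    field_simp
    ring
  have hPA : P.real (L ⁻¹' Set.Ici ε) = stdNormalCDF (-ε / μ + μ / 2) := by
    rw [← map_measureReal_apply hL measurableSet_Ici, hPL, gaussianReal_real_Ici _ hμ hs, hs]
    congr 1
    field_simp
    ring
  have hQA : Q.real (L ⁻¹' Set.Ici ε) = stdNormalCDF (-ε / μ - μ / 2) := by
    rw [← map_measureReal_apply hL measurableSet_Ici, hQ, gaussianReal_real_Ici _ hμ hs, hs]
    congr 1
    field_simp
    ring
  have hmain := measureReal_sub_le_of_withDensity_exp hL hP ε hS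
  rw [hPA, hQA] at hmain
  calc P S = ENNReal.ofReal (P.real S) := (ofReal_measureReal).symm
    _ ≤ ENNReal.ofReal (Real.exp ε * Q.real S + gdpCurve μ ε) :=
        ENNReal.ofReal_le_ofReal (by rw [gdpCurve]; linarith)
    _ ≤ _ := by
        refine ENNReal.ofReal_add_le.trans ?_
        rw [ENNReal.ofReal_mul (Real.exp_pos _).le, ofReal_measureReal]

/-- The privacy bound only needs the variance of the log-likelihood ratio to be at most `μ ^ 2`:
an independent Gaussian coordinate makes up the difference. -/
theorem HasGaussianLogLikelihood.le_gdpCurve_of_le {Ω : Type*} [MeasurableSpace Ω]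
    {P Q : Measure Ω} [IsProbabilityMeasure P] [IsProbabilityMeasure Q] {s : ℝ≥0}
    (h : HasGaussianLogLikelihood s P Q) {μ : ℝ} (hμ : 0 < μ) (hs : (s : ℝ) ≤ μ ^ 2) (ε : ℝ)
    {S : Set Ω} (hS : MeasurableSet S) :
    P S ≤ ENNReal.ofReal (Real.exp ε) * Q S + ENNReal.ofReal (gdpCurve μ ε) := by
  have hprod := h.prod (HasGaussianLogLikelihood.of_gaussianReal (√(μ ^ 2 - s)) 0 one_ne_zero)
  have hle := hprod.le_gdpCurve hμ (by simp [Real.sq_sqrt (sub_nonneg.2 hs)]) ε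
    (hS.prod MeasurableSet.univ)
  simpa only [Measure.prod_prod, measure_univ, mul_one] using hle

theorem pi_prod_gaussianReal_le_gdpCurve
    {n : ℕ} (hn : 1 ≤ n) {Δd Δs σ : ℝ} (hΔd : 0 < Δd) (hσ : 0 < σ)
    {v : ℝ≥0} (hv : (v : ℝ) = σ ^ 2) {u u' : Fin n → ℝ × ℝ}
    (h1 : ∀ i, |(u i).1 - (u' i).1| ≤ Δd) (h2 : ∀ i, |(u i).2 - (u' i).2| ≤ Δs)
    (ε : ℝ) {S : Set (Fin n → ℝ × ℝ)} (hS : MeasurableSet S) :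
    Measure.pi (fun i => (gaussianReal (u i).1 v).prod (gaussianReal (u i).2 v)) S ≤
      ENNReal.ofReal (Real.exp ε) *
        Measure.pi (fun i => (gaussianReal (u' i).1 v).prod (gaussianReal (u' i).2 v)) S +
        ENNReal.ofReal (gdpCurve (√(n * (Δs ^ 2 + Δd ^ 2)) / σ) ε) := by
  have hv0 : v ≠ 0 := by
    rw [← NNReal.coe_ne_zero, hv]
    exact (pow_pos hσ 2).ne'
  have hn0 : (0 : ℝ) < n := by exact_mod_cast hn
  have hμ2 : (√(n * (Δs ^ 2 + Δd ^ 2)) / σ) ^ 2 =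
      ∑ _i : Fin n, (Δd ^ 2 / σ ^ 2 + Δs ^ 2 / σ ^ 2) := by
    rw [div_pow, Real.sq_sqrt (by positivity), Finset.sum_const, Finset.card_univ,
      Fintype.card_fin, nsmul_eq_mul]
    ring
  refine (HasGaussianLogLikelihood.pi fun i =>
    (HasGaussianLogLikelihood.of_gaussianReal (u i).1 (u' i).1 hv0).prod
      (HasGaussianLogLikelihood.of_gaussianReal (u i).2 (u' i).2 hv0)).le_gdpCurve_of_le
        (by positivity) ?_ ε hS
  rw [hμ2, NNReal.coe_sum]
  refine Finset.sum_le_sum fun i _ => ?_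
  push_cast [hv, Real.coe_nnabs]
  have hd := h1 i
  have hs := h2 i
  gcongr

/-- Releasing n pointwise evaluations of the density and signal channels with the Gaussian
mechanism of noise variance σ² is μ-GDP with μ = √(n(Δ_s² + Δ_d²))/σ. -/
theorem pointwise_release_gdp
    (n : ℕ) (hn : 1 ≤ n) (Δd Δs σ : ℝ) (hΔd : 0 < Δd) (hΔs : 0 < Δs) (hσ : 0 < σ)
    (μ : ℝ) (hμ : μ = Real.sqrt (n * (Δs ^ 2 + Δd ^ 2)) / σ)
    (u u' : Fin n → ℝ × ℝ)
    (h1 : ∀ i, |(u i).1 - (u' i).1| ≤ Δd)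
    (h2 : ∀ i, |(u i).2 - (u' i).2| ≤ Δs)
    (ε : ℝ) (hε : 0 ≤ ε) (S : Set (Fin n → ℝ × ℝ)) (hS : MeasurableSet S) :
    Measure.pi (fun i => (gaussianReal (u i).1 ⟨σ ^ 2, sq_nonneg σ⟩).prod
        (gaussianReal (u i).2 ⟨σ ^ 2, sq_nonneg σ⟩)) S ≤
      ENNReal.ofReal (Real.exp ε) *
        Measure.pi (fun i => (gaussianReal (u' i).1 ⟨σ ^ 2, sq_nonneg σ⟩).prod
          (gaussianReal (u' i).2 ⟨σ ^ 2, sq_nonneg σ⟩)) S +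
        ENNReal.ofReal (gdpCurve μ ε) := by
  rw [hμ]
  exact pi_prod_gaussianReal_le_gdpCurve hn hΔd hσ rfl h1 h2 ε hS
end
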